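/- The map μ : ℝ × ℝ × V → Matrix (Fin 2) (Fin 2) ℂ defined by μ(r, φ, v) := e^r · !![1 + cos φ, sin φ; sin φ, 1 − cos φ] + i·v (real matrices regarded as complex) takes all its values in 𝒯, and the induced map ℝ × ℝ × V → 𝒯 (with 𝒯 carrying the subspace topology) is a surjective covering map; since ℝ × ℝ × V is simply connected, it is the universal covering of 𝒯. -/

import Mathlib

open Matrix Complex

/-- The tube `𝒯` over the future light cone, inside the space of symmetric
complex `2×2` matrices. -/
def lightConeTube : Set (Matrix (Fin 2) (Fin 2) ℂ) :=
  {z | zᵀ = z ∧ (z + z.map (starRingEnd ℂ)).det = 0 ∧ 0 < (Matrix.trace z).re}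

/-- `V`, the space of real symmetric `2×2` matrices. -/
def SymMat2 : Type := {v : Matrix (Fin 2) (Fin 2) ℝ // vᵀ = v}

instance : TopologicalSpace SymMat2 :=
  inferInstanceAs (TopologicalSpace {v : Matrix (Fin 2) (Fin 2) ℝ // vᵀ = v})

/-- The covering map `μ(r, φ, v) = eʳ·!![1+cos φ, sin φ; sin φ, 1−cos φ] + i·v`. -/
noncomputable def muMap (p : ℝ × ℝ × SymMat2) : Matrix (Fin 2) (Fin 2) ℂ :=
  (Real.exp p.1) •
      ((!![1 + Real.cos p.2.1, Real.sin p.2.1;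
           Real.sin p.2.1, 1 - Real.cos p.2.1]).map (Complex.ofReal))
    + Complex.I • (p.2.2.val.map (Complex.ofReal))


theorem IsEvenlyCovered.prodMap_id_aux {E X V I : Type*} [TopologicalSpace E] [TopologicalSpace X]
    [TopologicalSpace V] [TopologicalSpace I] {f : E → X} {x : X}
    (h : IsEvenlyCovered f x I) (v : V) :
    IsEvenlyCovered (fun p : E × V => (f p.1, p.2)) (x, v) I := by
  obtain ⟨inst, U, hxU, hU, hfU, H, hH⟩ := h
  refine ⟨inst, Prod.fst ⁻¹' U, hxU, hU.preimage continuous_fst,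
    hfU.preimage continuous_fst, ?_⟩
  have hs : ∀ y : U × I, f (H.symm y).1 = y.1.1 := fun y => by rw [← hH]; simp
  refine ⟨{ toFun := fun e => (⟨((H ⟨e.1.1, e.2⟩).1.1, e.1.2), (H ⟨e.1.1, e.2⟩).1.2⟩,
              (H ⟨e.1.1, e.2⟩).2)
            invFun := fun y => ⟨((H.symm (⟨y.1.1.1, y.1.2⟩, y.2)).1, y.1.1.2), by
              show f _ ∈ U
              rw [hs]; exact y.1.2⟩
            left_inv := ?_
            right_inv := ?_
            continuous_toFun := ?_
            continuous_invFun := ?_ }, ?_⟩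
  · rintro ⟨⟨e, v⟩, he⟩
    simp
  · rintro ⟨⟨⟨a, v⟩, ha⟩, i⟩
    simp
  · fun_prop
  · fun_prop
  · rintro ⟨⟨e, v⟩, he⟩
    simp [hH]

theorem IsCoveringMap.prodMap_id_aux {E X V : Type*} [TopologicalSpace E] [TopologicalSpace X]
    [TopologicalSpace V] {f : E → X} (h : IsCoveringMap f) :
    IsCoveringMap (fun p : E × V => (f p.1, p.2)) := by
  rintro ⟨x, v⟩
  exact ((h x).prodMap_id_aux v).to_isEvenlyCovered_preimage

/-- The underlying map `ℂ × V → Mat₂(ℂ)`. -/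
noncomputable def tubeFun (w : ℂ) (v : SymMat2) : Matrix (Fin 2) (Fin 2) ℂ :=
  !![((‖w‖ + w.re : ℝ) : ℂ) + I * (v.val 0 0 : ℝ), ((w.im : ℝ) : ℂ) + I * (v.val 0 1 : ℝ);
     ((w.im : ℝ) : ℂ) + I * (v.val 1 0 : ℝ), ((‖w‖ - w.re : ℝ) : ℂ) + I * (v.val 1 1 : ℝ)]

theorem norm_sq_aux (w : ℂ) : ‖w‖ ^ 2 = w.re ^ 2 + w.im ^ 2 := by
  rw [← Complex.normSq_eq_norm_sq, Complex.normSq_apply]; ring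

theorem SymMat2.symm_aux (v : SymMat2) : v.val 1 0 = v.val 0 1 :=
  congrFun (congrFun v.2 0) 1

theorem SymMat2.continuous_val : Continuous (fun v : SymMat2 => v.val) :=
  continuous_subtype_val

theorem tubeFun_mem (w : ℂ) (hw : w ≠ 0) (v : SymMat2) : tubeFun w v ∈ lightConeTube := by
  have h0 : 0 < ‖w‖ := norm_pos_iff.mpr hw
  have hn := norm_sq_aux w
  refine ⟨?_, ?_, ?_⟩
  · ext i j
    fin_cases i <;> fin_cases j <;> simp [tubeFun, v.symm_aux]
  · rw [Matrix.det_fin_two]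
    apply Complex.ext <;> simp [tubeFun]
    linarith
  · simpa [tubeFun, Matrix.trace_fin_two] using hw

theorem lightConeTube_facts {z : Matrix (Fin 2) (Fin 2) ℂ} (hz : z ∈ lightConeTube) :
    z 1 0 = z 0 1 ∧ (z 0 0).re * (z 1 1).re = (z 0 1).re ^ 2 ∧ 0 < (z 0 0).re + (z 1 1).re := by
  obtain ⟨h1, h2, h3⟩ := hz
  have hs : z 1 0 = z 0 1 := congrFun (congrFun h1 0) 1
  refine ⟨hs, ?_, ?_⟩
  · rw [Matrix.det_fin_two] at h2
    have := congrArg Complex.re h2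
    simp [hs] at this
    linarith
  · simpa [Matrix.trace_fin_two] using h3

/-- The `ℂ`-coordinate on the tube. -/
noncomputable def tubeW (z : Matrix (Fin 2) (Fin 2) ℂ) : ℂ :=
  (((z 0 0).re - (z 1 1).re) / 2 : ℝ) + ((z 0 1).re : ℝ) * I

theorem tubeW_norm {z : Matrix (Fin 2) (Fin 2) ℂ} (hz : z ∈ lightConeTube) :
    ‖tubeW z‖ = ((z 0 0).re + (z 1 1).re) / 2 := by
  obtain ⟨_, h2, h3⟩ := lightConeTube_facts hz
  have hn := norm_sq_aux (tubeW z)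
  have hr : (tubeW z).re = ((z 0 0).re - (z 1 1).re) / 2 := by
    simp only [tubeW, Complex.add_re, Complex.re_ofReal_mul, Complex.ofReal_re, Complex.I_re]; ring
  have hi : (tubeW z).im = (z 0 1).re := by
    simp only [tubeW, Complex.add_im, Complex.im_ofReal_mul, Complex.ofReal_im, Complex.I_im]; ring
  rw [hr, hi] at hn
  have : ‖tubeW z‖ ^ 2 = (((z 0 0).re + (z 1 1).re) / 2) ^ 2 := by rw [hn]; linarith
  exact (pow_left_inj₀ (norm_nonneg _) (by linarith) two_ne_zero).mp this

theorem tubeW_re (z : Matrix (Fin 2) (Fin 2) ℂ) :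
    (tubeW z).re = ((z 0 0).re - (z 1 1).re) / 2 := by
  simp only [tubeW, Complex.add_re, Complex.re_ofReal_mul, Complex.ofReal_re, Complex.I_re]; ring

theorem tubeW_im (z : Matrix (Fin 2) (Fin 2) ℂ) : (tubeW z).im = (z 0 1).re := by
  simp only [tubeW, Complex.add_im, Complex.im_ofReal_mul, Complex.ofReal_im, Complex.I_im]; ring

theorem tubeFun_tubeW {z : Matrix (Fin 2) (Fin 2) ℂ} (hz : z ∈ lightConeTube) (v : SymMat2)
    (hv : ∀ i j, v.val i j = (z i j).im) : tubeFun (tubeW z) v = z := by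
  have hs := (lightConeTube_facts hz).1
  unfold tubeFun
  rw [tubeW_re, tubeW_im, tubeW_norm hz, hv, hv, hv, hv, hs]
  have key : ∀ (a : ℝ) (c : ℂ), a = c.re → (a : ℂ) + I * (c.im : ℝ) = c := by
    rintro a c rfl
    rw [mul_comm]; exact Complex.re_add_im c
  rw [key _ (z 0 0) (by ring), key _ (z 0 1) rfl, key _ (z 1 1) (by ring)]
  conv_rhs => rw [Matrix.eta_fin_two z, hs]

theorem tubeFun_continuous :
    Continuous (fun p : {w : ℂ // w ≠ 0} × SymMat2 => tubeFun p.1.1 p.2) := by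
  have hv : ∀ i j, Continuous (fun p : {w : ℂ // w ≠ 0} × SymMat2 => ((p.2.val i j : ℝ) : ℂ)) :=
    fun i j => Complex.continuous_ofReal.comp
      ((SymMat2.continuous_val.comp continuous_snd).matrix_elem i j)
  have hw : Continuous (fun p : {w : ℂ // w ≠ 0} × SymMat2 => p.1.1) :=
    continuous_subtype_val.comp continuous_fst
  have hr := Complex.continuous_re.comp hw
  have hi := Complex.continuous_ofReal.comp (Complex.continuous_im.comp hw)
  have hp := Complex.continuous_ofReal.comp (hw.norm.add hr)
  have hm := Complex.continuous_ofReal.comp (hw.norm.sub hr)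
  refine continuous_matrix ?_
  rw [Fin.forall_fin_two, Fin.forall_fin_two, Fin.forall_fin_two]
  exact ⟨⟨hp.add (continuous_const.mul (hv 0 0)), hi.add (continuous_const.mul (hv 0 1))⟩,
    ⟨hi.add (continuous_const.mul (hv 1 0)), hm.add (continuous_const.mul (hv 1 1))⟩⟩

/-- The homeomorphism `ℂˣ × V ≃ 𝒯`. -/
noncomputable def tubeHomeo : {w : ℂ // w ≠ 0} × SymMat2 ≃ₜ lightConeTube where
  toFun p := ⟨tubeFun p.1.1 p.2, tubeFun_mem _ p.1.2 _⟩
  invFun z := (⟨tubeW z.1, by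
      have := lightConeTube_facts z.2
      rw [← norm_pos_iff, tubeW_norm z.2]; linarith⟩,
    ⟨z.1.map Complex.im, by rw [← Matrix.transpose_map, z.2.1]⟩)
  left_inv := by
    rintro ⟨⟨w, hw⟩, v⟩
    refine Prod.ext (Subtype.ext ?_) (Subtype.ext ?_)
    · apply Complex.ext
      · simp only [tubeW_re]; simp [tubeFun]
      · simp only [tubeW_im]; simp [tubeFun]
    · ext i j
      fin_cases i <;> fin_cases j <;> simp [tubeFun]
  right_inv := by
    rintro ⟨z, hz⟩
    exact Subtype.ext (tubeFun_tubeW hz _ fun i j => rfl)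
  continuous_toFun := tubeFun_continuous.subtype_mk _
  continuous_invFun := by
    have hv : ∀ i j, Continuous (fun z : lightConeTube => z.1 i j) :=
      fun i j => continuous_subtype_val.matrix_elem i j
    refine Continuous.prodMk (Continuous.subtype_mk ?_ _) (Continuous.subtype_mk ?_ _)
    · have h00 := Complex.continuous_re.comp (hv 0 0)
      have h01 := Complex.continuous_re.comp (hv 0 1)
      have h11 := Complex.continuous_re.comp (hv 1 1)
      exact (Complex.continuous_ofReal.comp ((h00.sub h11).div_const 2)).add
        ((Complex.continuous_ofReal.comp h01).mul continuous_const)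
    · exact continuous_subtype_val.matrix_map Complex.continuous_im

theorem muMap_eq (p : ℝ × ℝ × SymMat2) :
    muMap p = tubeFun (Complex.exp (p.1 + p.2.1 * I)) p.2.2 := by
  have hn : ‖Complex.exp (p.1 + p.2.1 * I)‖ = Real.exp p.1 := by
    rw [Complex.norm_exp]; simp
  have hr : (Complex.exp (p.1 + p.2.1 * I)).re = Real.exp p.1 * Real.cos p.2.1 := by
    rw [Complex.exp_re]; simp
  have hi : (Complex.exp (p.1 + p.2.1 * I)).im = Real.exp p.1 * Real.sin p.2.1 := by
    rw [Complex.exp_im]; simp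
  unfold tubeFun muMap
  rw [hn, hr, hi]
  ext i j
  fin_cases i <;> fin_cases j <;> simp <;> ring

/-- `ℝ × ℝ × V ≃ ℂ × V`. -/
noncomputable def sourceHomeo : ℝ × ℝ × SymMat2 ≃ₜ ℂ × SymMat2 :=
  (Homeomorph.prodAssoc ℝ ℝ SymMat2).symm.trans
    (Complex.equivRealProdCLM.symm.toHomeomorph.prodCongr (Homeomorph.refl SymMat2))

theorem sourceHomeo_apply (p : ℝ × ℝ × SymMat2) :
    sourceHomeo p = ((p.1 : ℂ) + p.2.1 * I, p.2.2) := by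
  refine Prod.ext ?_ rfl
  apply Complex.ext <;> simp [sourceHomeo] <;> rfl

instance SymMat2.contractible : ContractibleSpace SymMat2 := by
  have hc : Convex ℝ {v : Matrix (Fin 2) (Fin 2) ℝ | vᵀ = v} := by
    intro a ha b hb s t _ _ _
    simp only [Set.mem_ofPred_eq] at *
    rw [Matrix.transpose_add, Matrix.transpose_smul, Matrix.transpose_smul, ha, hb]
  exact hc.contractibleSpace ⟨0, Matrix.transpose_zero⟩

/-- `μ` takes its values in `𝒯`, the induced map `ℝ × ℝ × V → 𝒯` is a surjective
covering map, and `ℝ × ℝ × V` is simply connected; hence it is the universal covering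
of the tube `𝒯` over the future light cone. -/
theorem muMap_universal_covering :
    (∀ p : ℝ × ℝ × SymMat2, muMap p ∈ lightConeTube) ∧
    SimplyConnectedSpace (ℝ × ℝ × SymMat2) ∧
    ∀ h : ∀ p : ℝ × ℝ × SymMat2, muMap p ∈ lightConeTube,
      Function.Surjective (fun p : ℝ × ℝ × SymMat2 => (⟨muMap p, h p⟩ : lightConeTube)) ∧
      IsCoveringMap (fun p : ℝ × ℝ × SymMat2 => (⟨muMap p, h p⟩ : lightConeTube)) := by
  refine ⟨fun p => ?_, inferInstance, fun h => ?_⟩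
  · rw [muMap_eq]; exact tubeFun_mem _ (Complex.exp_ne_zero _) _
  · let q : ℂ × SymMat2 → {w : ℂ // w ≠ 0} × SymMat2 :=
      fun p => (⟨Complex.exp p.1, Complex.exp_ne_zero p.1⟩, p.2)
    have hq : IsCoveringMap q := Complex.isCoveringMap_exp.prodMap_id_aux
    have hqs : Function.Surjective q := by
      rintro ⟨⟨w, hw⟩, v⟩
      exact ⟨(Complex.log w, v), Prod.ext (Subtype.ext (Complex.exp_log hw)) rfl⟩
    have heq : (fun p : ℝ × ℝ × SymMat2 => (⟨muMap p, h p⟩ : lightConeTube))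
        = (tubeHomeo ∘ q) ∘ sourceHomeo := by
      funext p
      apply Subtype.ext
      simp only [Function.comp_apply, sourceHomeo_apply]
      exact muMap_eq p
    rw [heq]
    exact ⟨(tubeHomeo.surjective.comp hqs).comp sourceHomeo.surjective,
      (hq.homeomorph_comp tubeHomeo).comp_homeomorph sourceHomeo⟩
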